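/- arXiv:2605.17555 — 3 statements merged into one kernel-verified Lean document; each statement's English description precedes it below -/
import Mathlib

section
/- The schedule fills features strictly in order: for every t ∈ ℝ and all indices j, k : Fin M with j < k, if a k t > 0 then a j t = 1 (each feature is fully killed before the next begins to fill). -/
noncomputable def meltAmp (M : ℕ) (π : Fin M → ℝ) (k : Fin M) (t : ℝ) : ℝ :=
  min 1 (max 0 ((t * (∑ j, π j) - ∑ j ∈ Finset.Iio k, π j) / π k))

theorem stmt4 (M : ℕ) (π : Fin M → ℝ) (hπ : ∀ k, 0 < π k) (t : ℝ)
    (j k : Fin M) (hjk : j < k) (hk : 0 < meltAmp M π k t) :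
    meltAmp M π j t = 1 := by
  unfold meltAmp at hk ⊢
  have h1 : 0 < (t * (∑ j, π j) - ∑ j ∈ Finset.Iio k, π j) / π k := by
    rcases lt_max_iff.mp (lt_min_iff.mp hk).2 with h | h
    · exact absurd h (lt_irrefl _)
    · exact h
  have h2 : 0 < t * (∑ j, π j) - ∑ j ∈ Finset.Iio k, π j :=
    (div_pos_iff_of_pos_right (hπ k)).mp h1
  have h3 : π j + ∑ i ∈ Finset.Iio j, π i ≤ ∑ i ∈ Finset.Iio k, π i := by
    rw [← Finset.sum_insert (by simp)]
    apply Finset.sum_le_sum_of_subset_of_nonneg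
    · intro i hi
      rw [Finset.mem_insert, Finset.mem_Iio] at hi
      rw [Finset.mem_Iio]
      rcases hi with rfl | hi
      · exact hjk
      · exact hi.trans hjk
    · intro i _ _
      exact (hπ i).le
  apply min_eq_left
  apply le_max_of_le_right
  rw [le_div_iff₀ (hπ j)]
  linarith
end

section
/- The time parameter measures the fraction of persistence mass destroyed: for every t ∈ [0, 1], the destroyed mass satisfies ∑_k (a k t) · π k = t · Π. -/
lemma melt_aux (x : ℝ) (hx : 0 ≤ x) : ∀ (n : ℕ) (p : Fin n → ℝ), (∀ k, 0 < p k) →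
    ∑ k, min (p k) (max 0 (x - ∑ j ∈ Finset.Iio k, p j)) = min x (∑ j, p j) := by
  intro n
  induction n with
  | zero => intro p _; simp [hx]
  | succ n ih =>
    intro p hp
    have h1 : ∀ k : Fin n, ∑ j ∈ Finset.Iio k.castSucc, p j
        = ∑ j ∈ Finset.Iio k, p j.castSucc := by
      intro k
      rw [← Fin.map_castSuccEmb_Iio, Finset.sum_map]
      rfl
    have h2 : ∑ j ∈ Finset.Iio (Fin.last n), p j = ∑ j : Fin n, p j.castSucc := by
      have : Finset.Iio (Fin.last n) = Finset.univ.map Fin.castSuccEmb := by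
        ext j
        induction j using Fin.lastCases <;> simp
      rw [this, Finset.sum_map]
      rfl
    have h3 := hp (Fin.last n)
    rw [Fin.sum_univ_castSucc, Fin.sum_univ_castSucc, h2]
    simp only [h1]
    rw [ih (fun k => p k.castSucc) (fun k => hp _)]
    generalize ∑ j : Fin n, p j.castSucc = s
    grind

theorem stmt8 (M : ℕ) (π : Fin M → ℝ) (hπ : ∀ k, 0 < π k) (t : ℝ)
    (ht : t ∈ Set.Icc (0 : ℝ) 1) :
    ∑ k, meltAmp M π k t * π k = t * ∑ j, π j := by
  have hP : 0 ≤ ∑ j, π j := Finset.sum_nonneg fun k _ => (hπ k).le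
  have h := melt_aux (t * ∑ j, π j) (mul_nonneg ht.1 hP) M π hπ
  rw [min_eq_left (mul_le_of_le_one_left hP ht.2)] at h
  rw [← h]
  refine Finset.sum_congr rfl fun k _ => ?_
  have hk := hπ k
  unfold meltAmp
  rw [min_mul_of_nonneg _ _ hk.le, max_mul_of_nonneg _ _ hk.le, div_mul_cancel₀ _ hk.ne', one_mul,
    zero_mul]
end

section
/- Schedule-level version of the paper's β₁-progression Proposition: the function t ↦ card {k : Fin M | a k t < 1}, counting features not yet fully filled, is monotone nonincreasing on ℝ, equals M at t = 0, and equals 0 at t = 1. -/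
theorem meltAmp_lt_one_iff (M : ℕ) (π : Fin M → ℝ) (hπ : ∀ k, 0 < π k) (k : Fin M) (t : ℝ) :
    meltAmp M π k t < 1 ↔ t * (∑ j, π j) < (∑ j ∈ Finset.Iio k, π j) + π k := by
  unfold meltAmp
  rw [min_lt_iff, max_lt_iff, div_lt_one (hπ k)]
  constructor
  · rintro (h | ⟨_, h⟩)
    · exact absurd h (lt_irrefl _)
    · linarith
  · intro h
    exact Or.inr ⟨one_pos, by linarith⟩

theorem stmt11 (M : ℕ) (π : Fin M → ℝ) (hπ : ∀ k, 0 < π k) :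
    Antitone (fun t : ℝ => Set.ncard {k : Fin M | meltAmp M π k t < 1}) ∧
    Set.ncard {k : Fin M | meltAmp M π k 0 < 1} = M ∧
    Set.ncard {k : Fin M | meltAmp M π k 1 < 1} = 0 := by
  simp only [meltAmp_lt_one_iff M π hπ]
  refine ⟨?_, ?_, ?_⟩
  · intro s t hst
    apply Set.ncard_le_ncard _ (Set.toFinite _)
    intro k hk
    simp only [Set.mem_setOf_eq] at hk ⊢
    have h0 : 0 ≤ ∑ j, π j := Finset.sum_nonneg fun j _ => (hπ j).le
    exact lt_of_le_of_lt (mul_le_mul_of_nonneg_right hst h0) hk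
  · have h : {k : Fin M | 0 * (∑ j, π j) < (∑ j ∈ Finset.Iio k, π j) + π k} = Set.univ := by
      ext k
      simp only [Set.mem_setOf_eq, Set.mem_univ, iff_true, zero_mul]
      exact add_pos_of_nonneg_of_pos (Finset.sum_nonneg fun j _ => (hπ j).le) (hπ k)
    rw [h, Set.ncard_univ, Nat.card_eq_fintype_card, Fintype.card_fin]
  · have h : {k : Fin M | 1 * (∑ j, π j) < (∑ j ∈ Finset.Iio k, π j) + π k} = ∅ := by
      ext k
      simp only [Set.mem_setOf_eq, Set.mem_empty_iff_false, iff_false, one_mul, not_lt]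
      have hk : k ∉ Finset.Iio k := by simp
      rw [add_comm, ← Finset.sum_insert hk]
      exact Finset.sum_le_sum_of_subset_of_nonneg (Finset.subset_univ _)
        fun j _ _ => (hπ j).le
    rw [h, Set.ncard_empty]
end
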